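/- Let a, b be coprime integers with a < 0, b > 2 and −a > b, and let D = {0, 1, …, |a|−1}. For any N ∈ ℤ define the sequence N_0 = N and N_{j+1} = (bN_j − d_j)/a, where d_j is the unique element of D with d_j ≡ bN_j (mod a). Then there exists k ≥ 0 such that N_k = 0. -/

import Mathlib

/-- Let `a, b` be coprime integers with `a < 0`, `b > 2` and `−a > b`,
and `D = {0, 1, …, |a|−1}`. For any `N ∈ ℤ` define `N_0 = N` and
`N_{j+1} = (b N_j − d_j)/a`, where `d_j` is the unique element of `D` with
`d_j ≡ b N_j (mod a)` (equivalently, `b N_j = a N_{j+1} + d_j`).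
Then there exists `k ≥ 0` with `N_k = 0`. -/
theorem negative_base_modified_division_algorithm_terminates
    (a b : ℤ) (ha : a < 0) (hb : 2 < b) (hab : b < -a) (hcop : IsCoprime a b)
    (N : ℕ → ℤ) (d : ℕ → ℤ)
    (hd : ∀ j, 0 ≤ d j ∧ d j < |a|)
    (hrec : ∀ j, b * N j = a * N (j + 1) + d j) :
    ∃ k : ℕ, N k = 0 := by
  have habs : |a| = -a := abs_of_neg ha
  have hpos : ∀ j, 0 < N j → N (j + 1) ≤ 0 ∧ -N j < N (j + 1) := by
    intro j hj
    obtain ⟨h0, h1⟩ := hd j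
    have h2 := hrec j
    rw [habs] at h1
    constructor
    · by_contra hc
      have hc' : 1 ≤ N (j + 1) := by omega
      nlinarith [mul_pos (show (0 : ℤ) < b by omega) hj]
    · by_contra hc
      have hc' : N (j + 1) ≤ -N j := by omega
      nlinarith [mul_pos (show (0 : ℤ) < -a - b by omega) hj]
  have hneg : ∀ j, N j < 0 → 0 < N (j + 1) ∧ N (j + 1) ≤ -N j := by
    intro j hj
    obtain ⟨h0, h1⟩ := hd j
    have h2 := hrec j
    rw [habs] at h1
    constructor
    · by_contra hc
      have hc' : N (j + 1) ≤ 0 := by omega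
      nlinarith [mul_pos (show (0 : ℤ) < b by omega) (neg_pos.mpr hj)]
    · by_contra hc
      have hc' : -N j + 1 ≤ N (j + 1) := by omega
      nlinarith [mul_pos (show (0 : ℤ) < -a - b by omega) (neg_pos.mpr hj)]
  have key : ∀ n : ℕ, ∀ j, 0 ≤ N j → N j ≤ n → ∃ k : ℕ, N k = 0 := by
    intro n
    induction n with
    | zero => exact fun j h0 h1 => ⟨j, by push_cast at h1; omega⟩
    | succ n ih =>
      intro j h0 h1
      push_cast at h1
      rcases h0.eq_or_lt with h | h
      · exact ⟨j, h.symm⟩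
      obtain ⟨h2, h3⟩ := hpos j h
      rcases h2.eq_or_lt with h4 | h4
      · exact ⟨j + 1, h4⟩
      obtain ⟨h5, h6⟩ := hneg (j + 1) h4
      exact ih (j + 1 + 1) h5.le (by omega)
  rcases lt_or_ge (N 0) 0 with h | h
  · have h1 := (hneg 0 h).1
    exact key (N (0 + 1)).toNat (0 + 1) h1.le (by omega)
  · exact key (N 0).toNat 0 h (by omega)
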